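/- arXiv:2208.13475 — 5 statements merged into one kernel-verified Lean document; each statement's English description precedes it below -/
import Mathlib

section
/- Let s₁, s₂, t₁, t₂ be positive integers with s₁ < s₂ and t₁ < t₂. If s₂² − s₁² = t₂² − t₁² and 1/s₁² − 1/s₂² = 1/t₁² − 1/t₂² (as rational or real numbers), then s₁ = t₁ and s₂ = t₂. -/
/-- Lemma 4.4 (resonance removal, second-derivative version): for positive integers
`s₁ < s₂`, `t₁ < t₂`, if `s₂² − s₁² = t₂² − t₁²` and
`1/s₁² − 1/s₂² = 1/t₁² − 1/t₂²` (as real numbers), then `s₁ = t₁` and `s₂ = t₂`. -/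
theorem stmt_1 (s₁ s₂ t₁ t₂ : ℤ) (hs₁ : 0 < s₁) (ht₁ : 0 < t₁)
    (hs : s₁ < s₂) (ht : t₁ < t₂)
    (h1 : s₂ ^ 2 - s₁ ^ 2 = t₂ ^ 2 - t₁ ^ 2)
    (h2 : 1 / (s₁ : ℝ) ^ 2 - 1 / (s₂ : ℝ) ^ 2 = 1 / (t₁ : ℝ) ^ 2 - 1 / (t₂ : ℝ) ^ 2) :
    s₁ = t₁ ∧ s₂ = t₂ := by
  have hs₂ : 0 < s₂ := hs₁.trans hs
  have ht₂ : 0 < t₂ := ht₁.trans ht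
  have cleared : (s₂ ^ 2 - s₁ ^ 2) * (t₁ ^ 2 * t₂ ^ 2) =
      (t₂ ^ 2 - t₁ ^ 2) * (s₁ ^ 2 * s₂ ^ 2) := by
    have hs₁' : (s₁ : ℝ) ≠ 0 := by exact_mod_cast hs₁.ne'
    have hs₂' : (s₂ : ℝ) ≠ 0 := by exact_mod_cast hs₂.ne'
    have ht₁' : (t₁ : ℝ) ≠ 0 := by exact_mod_cast ht₁.ne'
    have ht₂' : (t₂ : ℝ) ≠ 0 := by exact_mod_cast ht₂.ne'
    field_simp at h2
    have h : ((s₂ : ℝ) ^ 2 - s₁ ^ 2) * (t₁ ^ 2 * t₂ ^ 2) =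
        (t₂ ^ 2 - t₁ ^ 2) * (s₁ ^ 2 * s₂ ^ 2) := by linear_combination h2
    exact_mod_cast h
  have gap : t₂ ^ 2 - t₁ ^ 2 ≠ 0 := by nlinarith
  have prod : t₁ ^ 2 * t₂ ^ 2 = s₁ ^ 2 * s₂ ^ 2 :=
    mul_left_cancel₀ gap (h1 ▸ cleared)
  have sum_pos : s₁ ^ 2 + t₂ ^ 2 ≠ 0 := by positivity
  have sq₁ : s₁ ^ 2 = t₁ ^ 2 := by
    refine sub_eq_zero.mp ((mul_eq_zero.mp ?_).resolve_right sum_pos)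
    linear_combination -s₁ ^ 2 * h1 - prod
  have sq₂ : s₂ ^ 2 = t₂ ^ 2 := by linear_combination h1 + sq₁
  exact ⟨(pow_left_inj₀ hs₁.le ht₁.le two_ne_zero).mp sq₁,
    (pow_left_inj₀ hs₂.le ht₂.le two_ne_zero).mp sq₂⟩
end

section
/- For all integers j, ℓ ≥ 1 with j ≠ ℓ, the integral ∫_{−1/2}^{1/2} φ_j(x) · (2x φ_ℓ′(x) + φ_ℓ(x)) dx equals 2jℓ(1 + (−1)^{j+ℓ}) / (ℓ² − j²). In particular it vanishes when j + ℓ is odd, so the operator xp + px = −i(2x d/dx + 1) only couples Dirichlet eigenfunctions whose indices differ by a nonzero even number, and ⟨φ_j, (xp+px) φ_ℓ⟩ = −i · 2jℓ(1 + (−1)^{j+ℓ})/(ℓ² − j²). -/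
open MeasureTheory intervalIntegral

/-- The `j`-th normalized Dirichlet eigenfunction of `−d²/dx²` on `[−1/2, 1/2]`:
`φ_j(x) = √2 · sin(jπ(x + 1/2))`. -/
noncomputable def dirichletEigenfunction (j : ℕ) (x : ℝ) : ℝ :=
  Real.sqrt 2 * Real.sin (j * Real.pi * (x + 1 / 2))

theorem integral_sin_mul_generator_sin {a b : ℝ} (hs : a + b ≠ 0) (hd : a - b ≠ 0)
    (ha : Real.sin a = 0) (hb : Real.sin b = 0) :
    ∫ x in (-(1 : ℝ) / 2)..(1 / 2),
        2 * (Real.sin (a * (x + 1 / 2)) *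
          (2 * x * (b * Real.cos (b * (x + 1 / 2))) + Real.sin (b * (x + 1 / 2))))
      = 2 * a * b * (1 + Real.cos a * Real.cos b) / (b ^ 2 - a ^ 2) := by
  have hcos (c x : ℝ) : HasDerivAt (fun x ↦ Real.cos (c * (x + 1 / 2)))
      (-Real.sin (c * (x + 1 / 2)) * (c * 1)) x :=
    (((hasDerivAt_id x).add_const (1 / 2)).const_mul c).cos
  have hsin (c x : ℝ) : HasDerivAt (fun x ↦ Real.sin (c * (x + 1 / 2)))
      (Real.cos (c * (x + 1 / 2)) * (c * 1)) x :=
    (((hasDerivAt_id x).add_const (1 / 2)).const_mul c).sin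
  rw [integral_eq_sub_of_hasDerivAt
    (f := fun x ↦ -(2 * b) * (x * (Real.cos ((a + b) * (x + 1 / 2)) / (a + b) +
        Real.cos ((a - b) * (x + 1 / 2)) / (a - b))) +
      (2 * b / (a + b) ^ 2 - 1 / (a + b)) * Real.sin ((a + b) * (x + 1 / 2)) +
      (2 * b / (a - b) ^ 2 + 1 / (a - b)) * Real.sin ((a - b) * (x + 1 / 2)))]
  · have hba : b ^ 2 - a ^ 2 ≠ 0 := by
      rw [show b ^ 2 - a ^ 2 = -((a + b) * (a - b)) by ring]
      exact neg_ne_zero.mpr (mul_ne_zero hs hd)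
    norm_num [Real.cos_add, Real.cos_sub, Real.sin_add, Real.sin_sub, ha, hb]
    field_simp
    ring
  · intro x _
    refine (((((hasDerivAt_id x).mul (((hcos (a + b) x).div_const (a + b)).add
      ((hcos (a - b) x).div_const (a - b)))).const_mul (-(2 * b))).add
      ((hsin (a + b) x).const_mul _)).add ((hsin (a - b) x).const_mul _)).congr_deriv ?_
    simp only [add_mul a b, sub_mul a b, Real.cos_add, Real.cos_sub, Real.sin_add, Real.sin_sub,
      id_eq, Pi.add_apply]
    field_simp
    ring
  · exact Continuous.intervalIntegrable (by fun_prop) _ _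

theorem deriv_dirichletEigenfunction (j : ℕ) (x : ℝ) :
    deriv (dirichletEigenfunction j) x =
      √2 * (j * Real.pi * Real.cos (j * Real.pi * (x + 1 / 2))) := by
  have h := ((((hasDerivAt_id x).add_const (1 / 2)).const_mul (j * Real.pi)).sin).const_mul √2
  refine (h.congr_deriv ?_).deriv
  simp only [id_eq]
  ring

theorem integral_dirichletEigenfunction_mul_generator {j ℓ : ℕ} (hj : 1 ≤ j) (hne : j ≠ ℓ) :
    (∫ x in (-(1 : ℝ) / 2)..(1 / 2),
        dirichletEigenfunction j x *
          (2 * x * deriv (dirichletEigenfunction ℓ) x + dirichletEigenfunction ℓ x))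
      = 2 * j * ℓ * (1 + (-1 : ℝ) ^ (j + ℓ)) / ((ℓ : ℝ) ^ 2 - (j : ℝ) ^ 2) := by
  have hs : (j : ℝ) * Real.pi + ℓ * Real.pi ≠ 0 := by
    have : (0 : ℝ) < j := by exact_mod_cast hj
    positivity
  have hd : (j : ℝ) * Real.pi - ℓ * Real.pi ≠ 0 := by
    rw [← sub_mul]
    exact mul_ne_zero (sub_ne_zero.mpr (by exact_mod_cast hne)) Real.pi_ne_zero
  have key := integral_sin_mul_generator_sin hs hd (Real.sin_nat_mul_pi j) (Real.sin_nat_mul_pi ℓ)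
  rw [Real.cos_nat_mul_pi, Real.cos_nat_mul_pi, ← pow_add] at key
  calc
    _ = _ := by
      refine integral_congr fun x _ ↦ ?_
      simp only [deriv_dirichletEigenfunction, dirichletEigenfunction]
      linear_combination (Real.sin (j * Real.pi * (x + 1 / 2)) *
        (2 * x * (ℓ * Real.pi * Real.cos (ℓ * Real.pi * (x + 1 / 2))) +
          Real.sin (ℓ * Real.pi * (x + 1 / 2)))) * Real.mul_self_sqrt zero_le_two
    _ = _ := key
    _ = _ := by
      rw [← mul_div_mul_right _ ((ℓ : ℝ) ^ 2 - j ^ 2) (pow_ne_zero 2 Real.pi_ne_zero)]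
      congr 1 <;> ring

/-- Matrix elements of the operator `xp + px = −i(2x d/dx + 1)` between Dirichlet
eigenfunctions: for `j ≠ ℓ`,
`∫_{−1/2}^{1/2} φ_j(x)(2x φ_ℓ′(x) + φ_ℓ(x)) dx = 2jℓ(1 + (−1)^{j+ℓ})/(ℓ² − j²)`;
in particular it vanishes when `j + ℓ` is odd, and
`⟨φ_j, (xp+px) φ_ℓ⟩ = −i · 2jℓ(1 + (−1)^{j+ℓ})/(ℓ² − j²)`. -/
theorem stmt_3 (j ℓ : ℕ) (hj : 1 ≤ j) (hℓ : 1 ≤ ℓ) (hne : j ≠ ℓ) :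
    (∫ x in (-(1 : ℝ) / 2)..(1 / 2),
        dirichletEigenfunction j x *
          (2 * x * deriv (dirichletEigenfunction ℓ) x + dirichletEigenfunction ℓ x))
      = 2 * j * ℓ * (1 + (-1 : ℝ) ^ (j + ℓ)) / ((ℓ : ℝ) ^ 2 - (j : ℝ) ^ 2)
    ∧ (Odd (j + ℓ) →
        (∫ x in (-(1 : ℝ) / 2)..(1 / 2),
          dirichletEigenfunction j x *
            (2 * x * deriv (dirichletEigenfunction ℓ) x + dirichletEigenfunction ℓ x)) = 0)
    ∧ (∫ x in (-(1 : ℝ) / 2)..(1 / 2),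
        Complex.ofReal (dirichletEigenfunction j x) *
          (-Complex.I * Complex.ofReal
            (2 * x * deriv (dirichletEigenfunction ℓ) x + dirichletEigenfunction ℓ x)))
      = -Complex.I *
          (2 * j * ℓ * (1 + (-1 : ℂ) ^ (j + ℓ)) / ((ℓ : ℂ) ^ 2 - (j : ℂ) ^ 2)) := by
  have h := integral_dirichletEigenfunction_mul_generator hj hne
  refine ⟨h, fun hodd ↦ ?_, ?_⟩
  · rw [h, hodd.neg_one_pow]
    simp
  · simp_rw [mul_left_comm _ (-Complex.I), ← Complex.ofReal_mul]
    rw [intervalIntegral.integral_const_mul, intervalIntegral.integral_ofReal, h]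
    push_cast
    rfl
end

section
/- For every integer j ≥ 1, the series over all integers ℓ ≥ 1 with j + ℓ odd of j²ℓ² / (j² − ℓ²)³ converges and its sum equals −π²/64. -/
lemma hasSum_nat_one_div_odd_sq :
    HasSum (fun n : ℕ => 1 / (2 * (n : ℝ) + 1) ^ 2) (Real.pi ^ 2 / 8) := by
  have hz := hasSum_zeta_two
  have he : HasSum (fun n : ℕ => (1 : ℝ) / ((2 * n : ℕ) : ℝ) ^ 2) (1 / 4 * (Real.pi ^ 2 / 6)) := by
    refine (hz.mul_left (1 / 4)).congr_fun fun n => ?_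
    push_cast
    rw [mul_pow, one_div_mul_one_div]
    norm_num
  have hinj : Function.Injective (fun n : ℕ => 2 * n + 1) := fun a b h => by
    simp only at h
    omega
  obtain ⟨s, ho⟩ : Summable (fun n : ℕ => (1 : ℝ) / ((2 * n + 1 : ℕ) : ℝ) ^ 2) :=
    hz.summable.comp_injective hinj
  have hsum := (HasSum.even_add_odd (f := fun n : ℕ => (1 : ℝ) / (n : ℝ) ^ 2) he ho).unique hz
  obtain rfl : s = Real.pi ^ 2 / 8 := by linarith
  refine ho.congr_fun fun n => ?_
  push_cast
  rfl

lemma hasSum_int_one_div_odd_sq :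
    HasSum (fun n : ℤ => 1 / (2 * (n : ℝ) + 1) ^ 2) (Real.pi ^ 2 / 4) := by
  have h := hasSum_nat_one_div_odd_sq
  have := HasSum.of_nat_of_neg_add_one (f := fun n : ℤ => 1 / (2 * (n : ℝ) + 1) ^ 2)
    (by simpa using h) (m' := Real.pi ^ 2 / 8) (by
      refine h.congr_fun fun n => ?_
      push_cast
      congr 1
      ring)
  convert this using 1
  ring

lemma hasSum_int_one_div_odd_cube :
    HasSum (fun n : ℤ => 1 / (2 * (n : ℝ) + 1) ^ 3) 0 := by
  have hs : Summable (fun n : ℕ => 1 / (2 * (n : ℝ) + 1) ^ 3) := by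
    refine hasSum_nat_one_div_odd_sq.summable.of_nonneg_of_le (fun n => by positivity) fun n => ?_
    have : (0 : ℝ) ≤ n := n.cast_nonneg
    gcongr
    · linarith
    · norm_num
  have h := hs.hasSum
  have := HasSum.of_nat_of_neg_add_one (f := fun n : ℤ => 1 / (2 * (n : ℝ) + 1) ^ 3)
    (by simpa using h) (by
      refine h.neg.congr_fun fun n => ?_
      push_cast
      rw [show 2 * (-((n : ℝ) + 1)) + 1 = -(2 * n + 1) by ring, Odd.neg_pow (by decide), div_neg])
  simpa using this

lemma two_mul_intCast_add_one_ne_zero (n : ℤ) : 2 * (n : ℝ) + 1 ≠ 0 := by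
  have : 2 * n + 1 ≠ 0 := by omega
  exact_mod_cast this

lemma tendsto_one_div_two_mul_add_one :
    Filter.Tendsto (fun n : ℕ => 1 / (2 * (n : ℝ) + 1)) Filter.atTop (nhds 0) := by
  simp only [one_div]
  exact Filter.Tendsto.inv_tendsto_atTop (Filter.tendsto_atTop_add_const_right _ _
    (tendsto_natCast_atTop_atTop.const_mul_atTop two_pos))

lemma hasSum_nat_one_div_odd_sub :
    HasSum (fun n : ℕ => 1 / (2 * (n : ℝ) + 1) - 1 / (2 * ((n : ℝ) + 1) + 1)) 1 := by
  rw [hasSum_iff_tendsto_nat_of_nonneg]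
  · have h (N : ℕ) : ∑ n ∈ Finset.range N,
        (1 / (2 * (n : ℝ) + 1) - 1 / (2 * ((n : ℝ) + 1) + 1)) = 1 - 1 / (2 * (N : ℝ) + 1) := by
      have := Finset.sum_range_sub' (fun n : ℕ => 1 / (2 * (n : ℝ) + 1)) N
      simpa using this
    simp only [h]
    simpa using tendsto_one_div_two_mul_add_one.const_sub 1
  · intro n
    rw [sub_nonneg]
    gcongr
    linarith

lemma hasSum_int_one_div_odd_sub :
    HasSum (fun n : ℤ => 1 / (2 * (n : ℝ) + 1) - 1 / (2 * ((n : ℝ) + 1) + 1)) 0 := by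
  have h := hasSum_nat_one_div_odd_sub
  have hneg : HasSum (fun n : ℕ => 1 / (2 * ((-((n : ℤ) + 1) : ℤ) : ℝ) + 1) -
      1 / (2 * (((-((n : ℤ) + 1) : ℤ) : ℝ) + 1) + 1)) (-1) := by
    rw [← hasSum_nat_add_iff' 1]
    have hval : (-1 : ℝ) - ∑ n ∈ Finset.range 1, (1 / (2 * ((-((n : ℤ) + 1) : ℤ) : ℝ) + 1) -
        1 / (2 * (((-((n : ℤ) + 1) : ℤ) : ℝ) + 1) + 1)) = 1 := by
      norm_num
    rw [hval]
    refine h.congr_fun fun n => ?_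
    push_cast
    rw [show 2 * (-((n : ℝ) + 1 + 1)) + 1 = -(2 * (n + 1) + 1) by ring,
      show 2 * (-((n : ℝ) + 1 + 1) + 1) + 1 = -(2 * n + 1) by ring, div_neg, div_neg]
    ring
  have := HasSum.of_nat_of_neg_add_one
    (f := fun n : ℤ => 1 / (2 * (n : ℝ) + 1) - 1 / (2 * ((n : ℝ) + 1) + 1))
    (by simpa using h) hneg
  simpa using this

lemma hasSum_int_one_div_odd_sub_shift (j : ℕ) :
    HasSum (fun n : ℤ => 1 / (2 * (n : ℝ) + 1) - 1 / (2 * ((n : ℝ) + j) + 1)) 0 := by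
  induction j with
  | zero => simp
  | succ j ih =>
    have h := (Equiv.addRight (j : ℤ)).hasSum_iff.mpr hasSum_int_one_div_odd_sub
    have := ih.add h
    rw [add_zero] at this
    refine this.congr_fun fun n => ?_
    simp only [Function.comp_apply, Equiv.coe_addRight]
    push_cast
    ring

lemma sq_mul_sq_div_sub_sq_cube {j a b : ℝ} (hj : j ≠ 0) (ha : a ≠ 0) (hb : b ≠ 0)
    (hab : b = a + 2 * j) :
    j ^ 2 * (a + j) ^ 2 / (j ^ 2 - (a + j) ^ 2) ^ 3 =
      1 / 16 * (2 * j * (1 / b ^ 3 - 1 / a ^ 3) - (1 / a ^ 2 + 1 / b ^ 2) +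
        1 / j * (1 / a - 1 / b)) := by
  rw [show j ^ 2 - (a + j) ^ 2 = -(a * b) by rw [hab]; ring]
  obtain rfl : j = (b - a) / 2 := by linarith
  have : b - a ≠ 0 := fun h => hj (by rw [h, zero_div])
  field_simp
  ring

lemma hasSum_int_odd_shift (j : ℕ) (hj : 1 ≤ j) :
    HasSum (fun n : ℤ => (j : ℝ) ^ 2 * (2 * (n : ℝ) + 1 + j) ^ 2 /
      ((j : ℝ) ^ 2 - (2 * (n : ℝ) + 1 + j) ^ 2) ^ 3) (-(Real.pi ^ 2 / 32)) := by
  have hj0 : (j : ℝ) ≠ 0 := by positivity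
  have h2 := hasSum_int_one_div_odd_sq
  have h3 := hasSum_int_one_div_odd_cube
  have h2' := (Equiv.addRight (j : ℤ)).hasSum_iff.mpr h2
  have h3' := (Equiv.addRight (j : ℤ)).hasSum_iff.mpr h3
  have h := ((((h3'.sub h3).mul_left (2 * (j : ℝ))).sub (h2.add h2')).add
    ((hasSum_int_one_div_odd_sub_shift j).mul_left (1 / (j : ℝ)))).mul_left (1 / 16)
  rw [show 1 / 16 * (2 * (j : ℝ) * (0 - 0) - (Real.pi ^ 2 / 4 + Real.pi ^ 2 / 4) + 1 / (j : ℝ) * 0)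
    = -(Real.pi ^ 2 / 32) by ring] at h
  refine h.congr_fun fun n => ?_
  have hb := two_mul_intCast_add_one_ne_zero (n + j)
  simp only [Function.comp_apply, Equiv.coe_addRight]
  push_cast at hb ⊢
  exact sq_mul_sq_div_sub_sq_cube hj0 (two_mul_intCast_add_one_ne_zero n) hb (by ring)

/-- For every integer `j ≥ 1`, the series over integers `ℓ ≥ 1` with `j + ℓ` odd of
`j²ℓ²/(j² − ℓ²)³` converges and its sum is `−π²/64`. -/
theorem stmt_5 (j : ℕ) (hj : 1 ≤ j) :
    HasSum
      (fun ℓ : ℕ =>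
        if 1 ≤ ℓ ∧ Odd (j + ℓ) then
          (j : ℝ) ^ 2 * (ℓ : ℝ) ^ 2 / ((j : ℝ) ^ 2 - (ℓ : ℝ) ^ 2) ^ 3
        else 0)
      (-(Real.pi ^ 2 / 64)) := by
  let G : ℤ → ℝ := fun l =>
    if Odd ((j : ℤ) + l) then (j : ℝ) ^ 2 * (l : ℝ) ^ 2 / ((j : ℝ) ^ 2 - (l : ℝ) ^ 2) ^ 3 else 0
  have hinj : Function.Injective (fun n : ℤ => 2 * n + 1 + (j : ℤ)) := fun a b h => by
    simp only at h
    omega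
  have hG : HasSum G (-(Real.pi ^ 2 / 32)) := by
    rw [← hinj.hasSum_iff]
    · refine (hasSum_int_odd_shift j hj).congr_fun fun n => ?_
      have hodd : Odd ((j : ℤ) + (2 * n + 1 + j)) := ⟨n + j, by ring⟩
      simp only [G, Function.comp_apply, if_pos hodd]
      push_cast
      rfl
    · intro l hl
      refine if_neg fun ⟨k, hk⟩ => hl ⟨k - j, ?_⟩
      simp only
      omega
  have h := hG.nat_add_neg.mul_left (1 / 2)
  have hval : 1 / 2 * (-(Real.pi ^ 2 / 32) + G 0) = -(Real.pi ^ 2 / 64) := by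
    simp only [G, Int.cast_zero, zero_pow two_ne_zero, mul_zero, zero_div, ite_self]
    ring
  rw [hval] at h
  refine h.congr_fun fun l => ?_
  have hneg : G (-(l : ℤ)) = G l := by
    have : Odd ((j : ℤ) + -(l : ℤ)) ↔ Odd ((j : ℤ) + l) := by
      simp only [Int.odd_add, even_neg]
    simp only [G, this, Int.cast_neg, neg_sq]
  have hcast : Odd ((j : ℤ) + l) ↔ Odd (j + l) := by exact_mod_cast Int.odd_coe_nat (j + l)
  rw [hneg]
  rcases Nat.eq_zero_or_pos l with rfl | hl
  · simp [G]
  · have : 1 ≤ l := hl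
    simp only [G, hcast, this, true_and, Int.cast_natCast]
    ring
end

section
/- For every integer j ≥ 1, the series over all integers ℓ ≥ 1 with ℓ ≠ j and j + ℓ even of j²ℓ² / (j² − ℓ²)³ converges and its sum equals 1/(32 j²) − π²/192. -/
open Filter Topology

/-- The telescoping series `∑ (1/(n+1) - 1/n)` over the naturals, with the convention `1/0 = 0`. -/
lemma hasSum_nat_inv_succ_sub_inv :
    HasSum (fun n : ℕ => ((n : ℝ) + 1)⁻¹ - (n : ℝ)⁻¹) 0 := by
  have hlim : Tendsto (fun n : ℕ => ((n : ℝ) + 1)⁻¹) atTop (𝓝 0) := by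
    simpa [one_div] using tendsto_one_div_add_atTop_nhds_zero_nat (𝕜 := ℝ)
  have htail : HasSum (fun n : ℕ => ((n : ℝ) + 1)⁻¹ - ((n : ℝ) + 1 + 1)⁻¹) 1 := by
    rw [hasSum_iff_tendsto_nat_of_nonneg]
    · have hsum : ∀ n : ℕ, ∑ i ∈ Finset.range n, (((i : ℝ) + 1)⁻¹ - ((i : ℝ) + 1 + 1)⁻¹)
          = 1 - ((n : ℝ) + 1)⁻¹ := by
        intro n
        induction n with
        | zero => simp
        | succ k ih => rw [Finset.sum_range_succ, ih]; push_cast; ring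
      simp only [hsum]
      simpa using hlim.const_sub 1
    · intro n
      rw [sub_nonneg]
      gcongr
      linarith
  rw [← hasSum_nat_add_iff' 1]
  simpa using htail.neg

/-- The telescoping series `∑ (1/(m+1) - 1/m)` over the integers, with the convention `1/0 = 0`. -/
lemma hasSum_int_inv_succ_sub_inv :
    HasSum (fun m : ℤ => ((m : ℝ) + 1)⁻¹ - (m : ℝ)⁻¹) 0 := by
  have h := hasSum_nat_inv_succ_sub_inv
  have hneg : HasSum (fun n : ℕ => (((-((n : ℤ) + 1) : ℤ) : ℝ) + 1)⁻¹
      - ((-((n : ℤ) + 1) : ℤ) : ℝ)⁻¹) 0 := by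
    convert h using 2 with n
    push_cast
    rw [show -((n : ℝ) + 1) + 1 = -n by ring, inv_neg, inv_neg]
    ring
  simpa using HasSum.of_nat_of_neg_add_one (f := fun m : ℤ => ((m : ℝ) + 1)⁻¹ - (m : ℝ)⁻¹)
    (by simpa using h) hneg

/-- The series `∑ (1/(m+j) - 1/m)` over the integers, with the convention `1/0 = 0`. -/
lemma hasSum_int_inv_add_nat_sub_inv (j : ℕ) :
    HasSum (fun m : ℤ => ((m : ℝ) + j)⁻¹ - (m : ℝ)⁻¹) 0 := by
  induction j with
  | zero => simp [hasSum_zero]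
  | succ k ih =>
    have h := (Equiv.addRight (k : ℤ)).hasSum_iff.mpr hasSum_int_inv_succ_sub_inv
    convert h.add ih using 1
    · ext m
      simp only [Function.comp_apply, Equiv.coe_addRight]
      push_cast
      rw [add_assoc]
      ring
    · simp

lemma hasSum_int_inv_sq :
    HasSum (fun m : ℤ => ((m : ℝ) ^ 2)⁻¹) (Real.pi ^ 2 / 3) := by
  have h : HasSum (fun n : ℕ => ((n : ℝ) ^ 2)⁻¹) (Real.pi ^ 2 / 6) := by
    simpa using hasSum_zeta_two
  have hsum := HasSum.of_nat_of_neg (f := fun m : ℤ => ((m : ℝ) ^ 2)⁻¹)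
    (by simpa using h) (by simpa using h)
  rwa [show Real.pi ^ 2 / 6 + Real.pi ^ 2 / 6 - (((0 : ℤ) : ℝ) ^ 2)⁻¹ = Real.pi ^ 2 / 3 by
    simp; ring] at hsum

lemma hasSum_int_inv_cube_add_nat_sub_inv_cube (j : ℕ) :
    HasSum (fun m : ℤ => (((m : ℝ) + j) ^ 3)⁻¹ - ((m : ℝ) ^ 3)⁻¹) 0 := by
  have h : Summable (fun m : ℤ => ((m : ℝ) ^ 3)⁻¹) := by
    simpa using (Real.summable_one_div_int_pow (p := 3)).mpr (by norm_num)
  have hs := (Equiv.addRight (j : ℤ)).hasSum_iff.mpr h.hasSum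
  simpa [Function.comp_def] using hs.sub h.hasSum

lemma partial_fractions {x y : ℝ} (hy : y ≠ 0) (hx : x ≠ 0) (hxy : x + y ≠ 0) :
    y ^ 2 * (y + 2 * x) ^ 2 / (y ^ 2 - (y + 2 * x) ^ 2) ^ 3 =
      y / 64 * (((x + y) ^ 3)⁻¹ - (x ^ 3)⁻¹) - 1 / 64 * ((x ^ 2)⁻¹ + ((x + y) ^ 2)⁻¹)
        - 1 / (32 * y) * ((x + y)⁻¹ - x⁻¹) := by
  rw [show y ^ 2 - (y + 2 * x) ^ 2 = -4 * x * (x + y) by ring]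
  field_simp
  ring

/-- The sum over all integers of the same parity as `j`; the terms at `±j` vanish since
division by zero gives zero. -/
lemma hasSum_int_same_parity (j : ℕ) (hj : 1 ≤ j) :
    HasSum (fun m : ℤ => (j : ℝ) ^ 2 * (j + 2 * m : ℝ) ^ 2 /
      ((j : ℝ) ^ 2 - (j + 2 * m : ℝ) ^ 2) ^ 3)
      (2 * (1 / (32 * (j : ℝ) ^ 2) - Real.pi ^ 2 / 192)) := by
  have hj0 : (j : ℝ) ≠ 0 := by positivity
  have hsq := hasSum_int_inv_sq
  have hsq' : HasSum (fun m : ℤ => (((m : ℝ) + j) ^ 2)⁻¹) (Real.pi ^ 2 / 3) := by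
    simpa [Function.comp_def] using (Equiv.addRight (j : ℤ)).hasSum_iff.mpr hsq
  have h0 := hasSum_ite_eq (0 : ℤ) (1 / (32 * (j : ℝ) ^ 2))
  have h1 := hasSum_ite_eq (-j : ℤ) (1 / (32 * (j : ℝ) ^ 2))
  have hsum := ((((hasSum_int_inv_cube_add_nat_sub_inv_cube j).mul_left ((j : ℝ) / 64)).sub
    ((hsq.add hsq').mul_left (1 / 64))).sub
    ((hasSum_int_inv_add_nat_sub_inv j).mul_left (1 / (32 * (j : ℝ))))).add (h0.add h1)
  have hval : 2 * (1 / (32 * (j : ℝ) ^ 2) - Real.pi ^ 2 / 192) =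
      j / 64 * 0 - 1 / 64 * (Real.pi ^ 2 / 3 + Real.pi ^ 2 / 3) - 1 / (32 * j) * 0 +
        (1 / (32 * (j : ℝ) ^ 2) + 1 / (32 * (j : ℝ) ^ 2)) := by ring
  rw [hval]
  refine hsum.congr_fun fun m => ?_
  · by_cases hm : m = 0
    · have : (0 : ℤ) ≠ -j := by omega
      subst hm
      simp only [this, if_true, if_false]
      simp
      field_simp
      ring
    by_cases hmj : m = -j
    · have : (-j : ℤ) ≠ 0 := by omega
      subst hmj
      simp only [this, if_true, if_false]
      push_cast
      rw [show (j : ℝ) ^ 2 - (j + 2 * -j) ^ 2 = 0 by ring, neg_add_cancel]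
      simp
      field_simp
      ring
    · simp only [hm, hmj, if_false, add_zero]
      apply partial_fractions hj0
      · exact_mod_cast hm
      · intro h
        apply hmj
        have : m + j = 0 := by exact_mod_cast h
        omega

/-- For every integer `j ≥ 1`, the series over integers `ℓ ≥ 1` with `ℓ ≠ j` and
`j + ℓ` even of `j²ℓ²/(j² − ℓ²)³` converges and its sum is `1/(32j²) − π²/192`. -/
theorem stmt_6 (j : ℕ) (hj : 1 ≤ j) :
    HasSum
      (fun ℓ : ℕ =>
        if 1 ≤ ℓ ∧ ℓ ≠ j ∧ Even (j + ℓ) then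
          (j : ℝ) ^ 2 * (ℓ : ℝ) ^ 2 / ((j : ℝ) ^ 2 - (ℓ : ℝ) ^ 2) ^ 3
        else 0)
      (1 / (32 * (j : ℝ) ^ 2) - Real.pi ^ 2 / 192) := by
  let H : ℤ → ℝ := fun ℓ => if Even ((j : ℤ) + ℓ) then
    (j : ℝ) ^ 2 * (ℓ : ℝ) ^ 2 / ((j : ℝ) ^ 2 - (ℓ : ℝ) ^ 2) ^ 3 else 0
  have hinj : Function.Injective (fun m : ℤ => (j : ℤ) + 2 * m) := by
    intro a b h
    simp only at h
    omega
  have hH : HasSum H (2 * (1 / (32 * (j : ℝ) ^ 2) - Real.pi ^ 2 / 192)) := by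
    rw [← hinj.hasSum_iff]
    · convert hasSum_int_same_parity j hj using 2 with m
      have : Even ((j : ℤ) + (j + 2 * m)) := ⟨j + m, by ring⟩
      simp only [Function.comp_apply, H, if_pos this]
      push_cast
      rfl
    · intro ℓ hℓ
      refine if_neg fun ⟨r, hr⟩ => hℓ ⟨r - j, ?_⟩
      simp only
      omega
  have hfold := (hH.nat_add_neg).mul_left (1 / 2)
  rw [show H 0 = 0 by simp [H], add_zero, ← mul_assoc, one_div_mul_cancel two_ne_zero,
    one_mul] at hfold
  refine hfold.congr_fun fun ℓ => ?_
  · have hpar : Even ((j : ℤ) + -(ℓ : ℤ)) ↔ Even (j + ℓ) := by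
      rw [← sub_eq_add_neg, Int.even_sub, Nat.even_add, Int.even_coe_nat, Int.even_coe_nat]
    have hpar' : Even ((j : ℤ) + (ℓ : ℤ)) ↔ Even (j + ℓ) := by
      exact_mod_cast Iff.rfl
    simp only [H, hpar, hpar']
    by_cases he : Even (j + ℓ)
    · rcases Nat.eq_zero_or_pos ℓ with rfl | hℓ
      · simp
      · by_cases hlj : ℓ = j
        · simp [hlj]
        · rw [if_pos ⟨hℓ, hlj, he⟩, if_pos he, if_pos he]
          push_cast
          rw [neg_sq]
          ring
    · simp [he]
end

section
/- For every integer j ≥ 1 and all real numbers λ, δ, the series over all integers ℓ ≥ 1 with ℓ ≠ j of the terms j²ℓ² · [λ²(1 + (−1)^{j+ℓ})² + 4δ²(1 − (−1)^{j+ℓ})²] / (π²(j² − ℓ²)³) converges and its sum equals λ²/(8j²π²) − λ²/48 − δ²/4. -/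
open Filter Topology

/-- The sum over `ℤ` of the consecutive differences of a function vanishing at both ends. -/
theorem hasSum_int_sub_succ {f : ℤ → ℝ} (htop : Tendsto f atTop (𝓝 0))
    (hbot : Tendsto f atBot (𝓝 0)) (hs : Summable fun m => f m - f (m + 1)) :
    HasSum (fun m => f m - f (m + 1)) 0 := by
  have hpos : HasSum (fun n : ℕ => f n - f (n + 1)) (f 0) := by
    have hsum : Summable (fun n : ℕ => f n - f (n + 1)) :=
      hs.comp_injective Nat.cast_injective
    rw [hsum.hasSum_iff_tendsto_nat]
    have h (n : ℕ) : ∑ i ∈ Finset.range n, (f i - f (i + 1)) = f 0 - f n :=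
      Finset.sum_range_sub' (fun i : ℕ => f i) n
    simp only [h]
    simpa only [sub_zero, Function.comp_def] using
      (htop.comp (tendsto_natCast_atTop_atTop (R := ℤ))).const_sub (f 0)
  have hneg : HasSum (fun n : ℕ => f (-(n + 1)) - f (-(n + 1) + 1)) (-f 0) := by
    have hsum : Summable (fun n : ℕ => f (-(n + 1)) - f (-(n + 1) + 1)) :=
      hs.comp_injective (i := fun n : ℕ => (-(n + 1) : ℤ)) fun a b h => by simpa using h
    rw [hsum.hasSum_iff_tendsto_nat]
    have h (n : ℕ) :
        ∑ i ∈ Finset.range n, (f (-(i + 1)) - f (-(i + 1) + 1)) = f (-n) - f 0 := by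
      simpa using Finset.sum_range_sub (fun i : ℕ => f (-i)) n
    simp only [h]
    simpa using ((hbot.comp tendsto_neg_atTop_atBot).comp
      tendsto_natCast_atTop_atTop).sub_const (f 0)
  have h := HasSum.of_nat_of_neg_add_one (f := fun m => f m - f (m + 1)) hpos hneg
  rwa [add_neg_cancel] at h

theorem hasSum_int_sub_add_nat {f : ℤ → ℝ} (d : ℕ) (htop : Tendsto f atTop (𝓝 0))
    (hbot : Tendsto f atBot (𝓝 0)) (hs : Summable fun m => f m - f (m + d)) :
    HasSum (fun m => f m - f (m + d)) 0 := by
  have h (m : ℤ) : (∑ k ∈ Finset.range d, f (m + k)) - ∑ k ∈ Finset.range d, f (m + 1 + k)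
      = f m - f (m + d) := by
    rw [← Finset.sum_sub_distrib]
    simpa [add_assoc, add_comm (1 : ℤ)] using
      Finset.sum_range_sub' (fun k : ℕ => f (m + k)) d
  have key := hasSum_int_sub_succ (f := fun m => ∑ k ∈ Finset.range d, f (m + k))
    (by simpa using tendsto_finsetSum (Finset.range d) fun k _ =>
          htop.comp (tendsto_atTop_add_const_right atTop (k : ℤ) tendsto_id))
    (by simpa using tendsto_finsetSum (Finset.range d) fun k _ =>
          hbot.comp (tendsto_atBot_add_const_right atBot (k : ℤ) tendsto_id))
  simp only [h] at key
  exact key hs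

/-- The function on `ℤ` equal to `A` at even integers and to `B` at odd integers. -/
noncomputable def parityWeight (A B : ℝ) (m : ℤ) : ℝ := if Even m then A else B

theorem parityWeight_neg (A B : ℝ) (m : ℤ) : parityWeight A B (-m) = parityWeight A B m := by
  simp [parityWeight]

theorem parityWeight_add_of_even (A B : ℝ) (m : ℤ) {d : ℤ} (hd : Even d) :
    parityWeight A B (m + d) = parityWeight A B m := by
  simp [parityWeight, Int.even_add, hd]

theorem abs_parityWeight_le (A B : ℝ) (m : ℤ) : |parityWeight A B m| ≤ |A| + |B| := by
  unfold parityWeight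
  split_ifs <;> linarith [abs_nonneg A, abs_nonneg B]

theorem hasSum_parityWeight_div_sq (A B : ℝ) :
    HasSum (fun m : ℤ => parityWeight A B m / (m : ℝ) ^ 2)
      (A * Real.pi ^ 2 / 12 + B * Real.pi ^ 2 / 4) := by
  have heven : HasSum (fun n : ℕ => if Even n then 1 / (n : ℝ) ^ 2 else 0)
      (Real.pi ^ 2 / 24) := by
    have hinj : Function.Injective fun n : ℕ => 2 * n := fun a b h => by simpa using h
    have hmul : HasSum (fun n : ℕ => if Even (2 * n) then 1 / ((2 * n : ℕ) : ℝ) ^ 2 else 0)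
        (Real.pi ^ 2 / 24) := by
      convert! hasSum_zeta_two.mul_left (1 / 4) using 1
      · ext n
        rw [if_pos (even_two_mul n)]
        push_cast
        ring
      · ring
    refine (hinj.hasSum_iff fun n hn => if_neg ?_).1 hmul
    rintro ⟨k, rfl⟩
    exact hn ⟨k, two_mul k⟩
  have hnat : HasSum (fun n : ℕ => parityWeight A B n / (n : ℝ) ^ 2)
      (A * Real.pi ^ 2 / 24 + B * Real.pi ^ 2 / 8) := by
    convert! (hasSum_zeta_two.mul_left B).add (heven.mul_left (A - B)) using 1
    · ext n
      by_cases h : Even n <;> simp [parityWeight, h] <;> ring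
    · ring
  convert! HasSum.of_nat_of_neg (f := fun m : ℤ => parityWeight A B m / (m : ℝ) ^ 2)
    (by simpa using hnat) (by simpa [parityWeight_neg] using hnat) using 1
  simp
  ring

theorem hasSum_parityWeight_div_cube (A B : ℝ) :
    HasSum (fun m : ℤ => parityWeight A B m / (m : ℝ) ^ 3) 0 := by
  have hs : Summable (fun n : ℕ => parityWeight A B n / (n : ℝ) ^ 3) := by
    refine Summable.of_norm_bounded
      ((Real.summable_one_div_nat_pow.2 (by norm_num : 1 < 3)).mul_left (|A| + |B|)) fun n => ?_
    rw [Real.norm_eq_abs, abs_div, abs_of_nonneg (by positivity : (0 : ℝ) ≤ (n : ℝ) ^ 3),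
      mul_one_div]
    gcongr
    exact abs_parityWeight_le A B n
  convert! HasSum.of_nat_of_neg (f := fun m : ℤ => parityWeight A B m / (m : ℝ) ^ 3)
    (by simpa using hs.hasSum)
    (by simpa [parityWeight_neg, Odd.neg_pow (by decide : Odd 3), div_neg] using hs.hasSum.neg)
    using 1
  simp

theorem abs_inv_sub_inv_add_le (m : ℤ) (d : ℕ) :
    |((m : ℝ))⁻¹ - ((m : ℝ) + d)⁻¹| ≤ d * (((m : ℝ) ^ 2)⁻¹ + (((m : ℝ) + d) ^ 2)⁻¹) := by
  rcases eq_or_ne d 0 with rfl | hd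
  · simp
  have hd0 : (0 : ℝ) < d := by positivity
  by_cases h0 : (m : ℝ) = 0
  · rw [h0]
    simp
    apply le_of_eq
    field_simp
  by_cases h1 : (m : ℝ) + d = 0
  · have : (m : ℝ) = -d := by linarith
    rw [this]
    simp
    apply le_of_eq
    field_simp
  have e : (m : ℝ)⁻¹ - ((m : ℝ) + d)⁻¹ = d * ((m : ℝ)⁻¹ * ((m : ℝ) + d)⁻¹) := by
    field_simp
    ring
  rw [e, abs_mul, abs_of_pos hd0, ← inv_pow, ← inv_pow]
  gcongr
  rw [abs_le]
  constructor <;>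
    nlinarith [sq_nonneg ((m : ℝ)⁻¹ + ((m : ℝ) + d)⁻¹), sq_nonneg ((m : ℝ)⁻¹ - ((m : ℝ) + d)⁻¹),
      sq_nonneg (m : ℝ)⁻¹, sq_nonneg ((m : ℝ) + d)⁻¹]

theorem hasSum_parityWeight_inv_sub_inv (A B : ℝ) {d : ℕ} (hd : Even d) :
    HasSum (fun m : ℤ => parityWeight A B m * ((m : ℝ)⁻¹ - ((m : ℝ) + d)⁻¹)) 0 := by
  have hd' : Even (d : ℤ) := by exact_mod_cast hd
  have hinv : Summable fun m : ℤ => ((m : ℝ) ^ 2)⁻¹ := by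
    simpa [parityWeight] using (hasSum_parityWeight_div_sq 1 1).summable
  have hinv' : Summable fun m : ℤ => (((m : ℝ) + d) ^ 2)⁻¹ := by
    simpa [Function.comp_def] using (Equiv.addRight (d : ℤ)).summable_iff.2 hinv
  have hs : Summable fun m : ℤ => parityWeight A B m * ((m : ℝ)⁻¹ - ((m : ℝ) + d)⁻¹) := by
    refine Summable.of_norm_bounded (((hinv.add hinv').mul_left (d : ℝ)).mul_left (|A| + |B|))
      fun m => ?_
    rw [Real.norm_eq_abs, abs_mul]
    exact mul_le_mul (abs_parityWeight_le A B m) (abs_inv_sub_inv_add_le m d) (abs_nonneg _)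
      (by positivity)
  have hlim {l : Filter ℤ} (hl : Tendsto (fun m : ℤ => (m : ℝ)⁻¹) l (𝓝 0)) :
      Tendsto (fun m : ℤ => parityWeight A B m * (m : ℝ)⁻¹) l (𝓝 0) := by
    refine squeeze_zero_norm (a := fun m : ℤ => (|A| + |B|) * ‖(m : ℝ)⁻¹‖) (fun m => ?_) ?_
    swap
    · simpa using hl.norm.const_mul (|A| + |B|)
    rw [norm_mul]
    exact mul_le_mul_of_nonneg_right (abs_parityWeight_le A B m) (norm_nonneg _)
  have h (m : ℤ) : parityWeight A B m * (m : ℝ)⁻¹ -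
      parityWeight A B (m + d) * (((m + d : ℤ) : ℝ))⁻¹
      = parityWeight A B m * ((m : ℝ)⁻¹ - ((m : ℝ) + d)⁻¹) := by
    rw [parityWeight_add_of_even A B m hd']
    push_cast
    ring
  have key := hasSum_int_sub_add_nat (f := fun m : ℤ => parityWeight A B m * (m : ℝ)⁻¹) d
    (hlim (tendsto_inv_atTop_zero.comp tendsto_intCast_atTop_atTop))
    (hlim (tendsto_inv_atBot_zero.comp (tendsto_intCast_atBot_iff.2 tendsto_id)))
  simp only [h] at key
  exact key hs

theorem sq_div_cube_partial_fractions (j x : ℝ) (hj : j ≠ 0) :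
    j ^ 2 * x ^ 2 / (j ^ 2 - x ^ 2) ^ 3 =
      -(j / 8) * (1 / (x - j) ^ 3 - 1 / (x + j) ^ 3
        + (1 / (x - j) ^ 2 + 1 / (x + j) ^ 2) / (2 * j)
        - ((x - j)⁻¹ - (x + j)⁻¹) / (2 * j ^ 2))
      + ((if x = j then 1 / (32 * j ^ 2) else 0) + if x = -j then 1 / (32 * j ^ 2) else 0) := by
  have hjj : j ≠ -j := fun h => hj (by linarith)
  by_cases h1 : x = j
  · subst h1
    simp [hjj]
    field_simp
    ring
  by_cases h2 : x = -j
  · subst h2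
    simp [hjj.symm]
    field_simp
    ring
  have h3 : x - j ≠ 0 := sub_ne_zero.2 h1
  have h4 : x + j ≠ 0 := fun h => h2 (by linarith)
  have h5 : j ^ 2 - x ^ 2 = -((x - j) * (x + j)) := by ring
  rw [if_neg h1, if_neg h2, h5]
  field_simp
  ring

theorem hasSum_int_parityWeight_sq_div_cube (A B : ℝ) {j : ℕ} (hj : j ≠ 0) :
    HasSum (fun l : ℤ => parityWeight A B (l - j) *
        ((j : ℝ) ^ 2 * (l : ℝ) ^ 2 / ((j : ℝ) ^ 2 - (l : ℝ) ^ 2) ^ 3))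
      (A / (16 * (j : ℝ) ^ 2) - A * Real.pi ^ 2 / 96 - B * Real.pi ^ 2 / 32) := by
  have hj0 : (j : ℝ) ≠ 0 := by exact_mod_cast hj
  have hsub {f : ℤ → ℝ} {a : ℝ} (h : HasSum f a) : HasSum (fun l : ℤ => f (l - j)) a :=
    (Equiv.subRight (j : ℤ)).hasSum_iff.2 h
  have hadd {f : ℤ → ℝ} {a : ℝ} (h : HasSum f a) : HasSum (fun l : ℤ => f (l + j)) a :=
    (Equiv.addRight (j : ℤ)).hasSum_iff.2 h
  have hw (l : ℤ) : parityWeight A B (l + j) = parityWeight A B (l - j) := by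
    rw [← parityWeight_add_of_even A B (l - j) (even_two_mul (j : ℤ))]
    congr 1
    ring
  have hcube := hasSum_parityWeight_div_cube A B
  have hsq := hasSum_parityWeight_div_sq A B
  have hinv := hsub (hasSum_parityWeight_inv_sub_inv A B (even_two_mul j))
  have hmain := ((((hsub hcube).sub (hadd hcube)).add
    (((hsub hsq).add (hadd hsq)).div_const (2 * (j : ℝ)))).sub
      (hinv.div_const (2 * (j : ℝ) ^ 2))).mul_left (-((j : ℝ) / 8))
  have hpt := (hasSum_ite_eq (j : ℤ) (A / (32 * (j : ℝ) ^ 2))).add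
    (hasSum_ite_eq (-j : ℤ) (A / (32 * (j : ℝ) ^ 2)))
  convert! hmain.add hpt using 1
  · ext l
    rw [sq_div_cube_partial_fractions _ _ hj0, hw]
    have e1 : ((l : ℝ) = j) ↔ l = j := by norm_cast
    have e2 : ((l : ℝ) = -j) ↔ l = -j := by norm_cast
    have e3 : ((l - j : ℤ) : ℝ) + ((2 * j : ℕ) : ℝ) = l + j := by push_cast; ring
    have p1 : parityWeight A B (l - j) * (if l = j then 1 / (32 * (j : ℝ) ^ 2) else 0)
        = if l = j then A / (32 * (j : ℝ) ^ 2) else 0 := by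
      split_ifs with h
      · simp [h, parityWeight, div_eq_mul_inv]
      · simp
    have p2 : parityWeight A B (l - j) * (if l = -j then 1 / (32 * (j : ℝ) ^ 2) else 0)
        = if l = -j then A / (32 * (j : ℝ) ^ 2) else 0 := by
      split_ifs with h
      · rw [← hw]
        simp [h, parityWeight, div_eq_mul_inv]
      · simp
    simp only [e1, e2]
    rw [mul_add, mul_add, p1, p2, e3]
    push_cast
    ring
  · field_simp
    ring


/-- Eq. (4.26) of the paper: for every `j ≥ 1` and all real `λ, δ`, the series over
integers `ℓ ≥ 1` with `ℓ ≠ j` of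
`j²ℓ²[λ²(1 + (−1)^{j+ℓ})² + 4δ²(1 − (−1)^{j+ℓ})²]/(π²(j² − ℓ²)³)`
converges with sum `λ²/(8j²π²) − λ²/48 − δ²/4`. -/
theorem stmt_7 (j : ℕ) (hj : 1 ≤ j) (lam δ : ℝ) :
    HasSum
      (fun ℓ : ℕ =>
        if 1 ≤ ℓ ∧ ℓ ≠ j then
          (j : ℝ) ^ 2 * (ℓ : ℝ) ^ 2 *
              (lam ^ 2 * (1 + (-1 : ℝ) ^ (j + ℓ)) ^ 2
                + 4 * δ ^ 2 * (1 - (-1 : ℝ) ^ (j + ℓ)) ^ 2) /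
            (Real.pi ^ 2 * ((j : ℝ) ^ 2 - (ℓ : ℝ) ^ 2) ^ 3)
        else 0)
      (lam ^ 2 / (8 * (j : ℝ) ^ 2 * Real.pi ^ 2) - lam ^ 2 / 48 - δ ^ 2 / 4) := by
  
  have h := (hasSum_int_parityWeight_sq_div_cube (4 * lam ^ 2) (16 * δ ^ 2)
    (Nat.one_le_iff_ne_zero.1 hj)).nat_add_neg.div_const (2 * Real.pi ^ 2)
  have hpi := Real.pi_ne_zero
  have hj0 : (j : ℝ) ≠ 0 := by positivity
  convert! h using 1
  · ext ℓ
    have hneg : parityWeight (4 * lam ^ 2) (16 * δ ^ 2) (-ℓ - j)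
        = parityWeight (4 * lam ^ 2) (16 * δ ^ 2) (j + ℓ : ℕ) := by
      rw [← parityWeight_neg]
      congr 1
      push_cast
      ring
    have hpos : parityWeight (4 * lam ^ 2) (16 * δ ^ 2) (ℓ - j)
        = parityWeight (4 * lam ^ 2) (16 * δ ^ 2) (j + ℓ : ℕ) := by
      rw [← parityWeight_add_of_even _ _ (ℓ - j : ℤ) (even_two_mul (j : ℤ))]
      congr 1
      push_cast
      ring
    have hw : lam ^ 2 * (1 + (-1 : ℝ) ^ (j + ℓ)) ^ 2 + 4 * δ ^ 2 * (1 - (-1 : ℝ) ^ (j + ℓ)) ^ 2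
        = parityWeight (4 * lam ^ 2) (16 * δ ^ 2) (j + ℓ : ℕ) := by
      simp only [parityWeight, Int.even_coe_nat]
      rcases Nat.even_or_odd (j + ℓ) with he | ho
      · rw [if_pos he, he.neg_one_pow]
        ring
      · rw [if_neg (Nat.not_even_iff_odd.2 ho), ho.neg_one_pow]
        ring
    rw [hneg, hpos, hw]
    push_cast
    rw [neg_sq]
    split_ifs with hℓ
    · generalize ((j : ℝ) ^ 2 - (ℓ : ℝ) ^ 2) ^ 3 = D
      ring
    · rcases Nat.eq_zero_or_pos ℓ with rfl | hp
      · simp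
      · obtain rfl : ℓ = j := by by_contra hne; exact hℓ ⟨hp, hne⟩
        simp
  · simp
    field_simp
    ring
end
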